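/- Let P¹, P² : B → B be two idempotent 𝕜-linear maps such that both boundary value problems D_{P¹} : dom(D_{P¹}) → H and D_{P²} : dom(D_{P²}) → H are bijective. Then for every f ∈ H there is a unique n ∈ N with P¹(γ n) = P¹(γ(D_{P²}^{−1} f)), and the relative parametrix formula D_{P¹}^{−1} f = D_{P²}^{−1} f − n holds; equivalently, D_{P¹}^{−1} = D_{P²}^{−1} − 𝒦(P¹) ∘ P¹ ∘ γ ∘ D_{P²}^{−1}, where 𝒦(P¹) (the abstract 'Poisson operator') assigns to an element p of range P¹ the unique n ∈ N with P¹(γ n) = p. -/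

import Mathlib

namespace RelZeta

variable {𝕜 : Type*} [Field 𝕜] {W H B : Type*}
  [AddCommGroup W] [Module 𝕜 W] [AddCommGroup H] [Module 𝕜 H]
  [AddCommGroup B] [Module 𝕜 B]

/-- The Calderon subspace `K = γ(N) = γ(ker D) ⊆ B`. -/
def Calderon (D : W →ₗ[𝕜] H) (γ : W →ₗ[𝕜] B) : Submodule 𝕜 B :=
  (LinearMap.ker D).map γ

/-- The domain `dom(D_P) = {u ∈ W : P(γ u) = 0}` of the boundary value problem. -/
def bvpDom (γ : W →ₗ[𝕜] B) (P : B →ₗ[𝕜] B) : Submodule 𝕜 W :=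
  LinearMap.ker (P.comp γ)

/-- The boundary value problem `D_P : dom(D_P) → H`, the restriction of `D`. -/
def bvp (D : W →ₗ[𝕜] H) (γ : W →ₗ[𝕜] B) (P : B →ₗ[𝕜] B) :
    ↥(bvpDom γ P) →ₗ[𝕜] H :=
  D.comp (bvpDom γ P).subtype

/-- `S(P) : K → range P`, the restriction of `P` to the Calderon subspace. -/
def SP (D : W →ₗ[𝕜] H) (γ : W →ₗ[𝕜] B) (P : B →ₗ[𝕜] B) :
    ↥(Calderon D γ) →ₗ[𝕜] ↥(LinearMap.range P) :=
  LinearMap.codRestrict (LinearMap.range P) (P.comp (Calderon D γ).subtype)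
    (fun c => LinearMap.mem_range_self P _)

/-- If `D_P` is injective, then elements of `W` with the same image under `D` and under `P ∘ γ`
coincide. -/
theorem eq_of_bvp_injective {D : W →ₗ[𝕜] H} {γ : W →ₗ[𝕜] B} {P : B →ₗ[𝕜] B}
    (h : Function.Injective (bvp D γ P)) {u v : W} (hD : D u = D v)
    (hP : P (γ u) = P (γ v)) : u = v := by
  have hmem : u - v ∈ bvpDom γ P := by simp [bvpDom, hP]
  have hzero : (⟨u - v, hmem⟩ : bvpDom γ P) = 0 := h (by simp [bvp, hD])
  exact sub_eq_zero.mp (congrArg Subtype.val hzero)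

/-- Relative parametrix: if `D_{P¹}` and `D_{P²}` are bijective then for every `f ∈ H`
there is a unique `n ∈ N = ker D` with `P¹(γ n) = P¹(γ(D_{P²}⁻¹ f))`, and
`D_{P¹}⁻¹ f = D_{P²}⁻¹ f − n`; equivalently
`D_{P¹}⁻¹ = D_{P²}⁻¹ − 𝒦(P¹) ∘ P¹ ∘ γ ∘ D_{P²}⁻¹`, where the Poisson operator `𝒦(P¹)`
assigns to `p ∈ range P¹` the unique `n ∈ N` with `P¹(γ n) = p`.
(Here `u₁ = D_{P¹}⁻¹ f` and `u₂ = D_{P²}⁻¹ f` are the unique solutions in the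
respective domains.) -/
theorem statement11 (D : W →ₗ[𝕜] H) (γ : W →ₗ[𝕜] B) (P1 P2 : B →ₗ[𝕜] B)
    (hDsurj : Function.Surjective D)
    (hγinj : Set.InjOn γ (LinearMap.ker D))
    (hP1idem : P1.comp P1 = P1) (hP2idem : P2.comp P2 = P2)
    (hb1 : Function.Bijective (bvp D γ P1))
    (hb2 : Function.Bijective (bvp D γ P2)) :
    ∀ f : H, ∀ u1 u2 : W,
      P1 (γ u1) = 0 → P2 (γ u2) = 0 → D u1 = f → D u2 = f →
        (∃! n : W, n ∈ LinearMap.ker D ∧ P1 (γ n) = P1 (γ u2)) ∧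
        ∀ n : W, n ∈ LinearMap.ker D → P1 (γ n) = P1 (γ u2) → u1 = u2 - n := by
  rintro f u1 u2 h1 - hD1 hD2
  refine ⟨⟨u2 - u1, ⟨by simp [hD1, hD2], by simp [h1]⟩, ?_⟩, ?_⟩
  · rintro n ⟨hn, hPn⟩
    rw [LinearMap.mem_ker] at hn
    exact eq_of_bvp_injective hb1.injective (by simp [hn, hD1, hD2]) (by simp [h1, hPn])
  · intro n hn hPn
    rw [LinearMap.mem_ker] at hn
    exact eq_of_bvp_injective hb1.injective (by simp [hn, hD1, hD2]) (by simp [h1, hPn])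

end RelZeta
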